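/- arXiv:2604.18974 — 3 statements merged into one kernel-verified Lean document; each statement's English description precedes it below -/
import Mathlib

section
/- Let n ≥ 3 and 2 ≤ m < n be integers, α = 1 or α = 1/m, and c > 0. Let ξ, χ : (0, ∞) → ℝ be twice continuously differentiable positive functions with ξ' > 0 and χ nondecreasing, with r ↦ ξ'(r)/ξ(r) positive and decreasing, r ↦ (ξ'χ')/(ξχ) nonincreasing, and with the expansions ξ'(r)/ξ(r) = 1/r + O(r), (ξ'/ξ)'(r) = −1/r² + O(1), χ'(r)/χ(r) = O(r), (χ'/χ)'(r) = O(1) and χ(r) → 1 as r → 0⁺. Define G(r, y) = C(n−1, m−1)^{−1} (ξ(r)/ξ'(r))^{m−1} · ((1 − y²)/y) · [ S_m(r) − (c χ(r))^{1/α} y^{1/α} (1 − y²)^{−m/2} ] for (r, y) ∈ (0, ∞) × (0, 1), and let Γ(r) ∈ (0, 1) be defined by Γ(r)^{1/α}(1 − Γ(r)²)^{−m/2} = S_m(r)/(c χ(r))^{1/α}. Then there exists a unique continuous function y : [0, ∞) → (0, 1] with y(0) = 1, differentiable on (0, ∞), such that y'(r) = G(r, y(r)) and Γ(r) < y(r)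 < 1 for all r > 0. -/
open Real Set Filter Topology Asymptotics

/-- The `m`-th mean curvature of the Killing cylinder of radius `r`, with the
convention `C(n-1, n) = 0` (automatic for `Nat.choose`). -/
noncomputable def cylSm (n m : ℕ) (ξ ξ' χ χ' : ℝ → ℝ) (r : ℝ) : ℝ :=
  (((n - 1).choose (m - 1) : ℝ) * (χ' r / χ r) + ((n - 1).choose m : ℝ) * (ξ' r / ξ r)) *
    (ξ' r / ξ r) ^ (m - 1)

/-- The right-hand side `G(r, y)` of the soliton equation written in terms of
`y = cos φ`. -/
noncomputable def solitonG (n m : ℕ) (α c : ℝ) (ξ ξ' χ χ' : ℝ → ℝ) (r y : ℝ) : ℝ :=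
  (((n - 1).choose (m - 1) : ℝ))⁻¹ * (ξ r / ξ' r) ^ (m - 1) * ((1 - y ^ 2) / y) *
    (cylSm n m ξ ξ' χ χ' r -
      (c * χ r) ^ (1 / α) * y ^ (1 / α) * (1 - y ^ 2) ^ (-(m : ℝ) / 2))


lemma barrier_le {f f' : ℝ → ℝ} {a b K : ℝ}
    (hf : ∀ t ∈ Icc a b, HasDerivWithinAt f (f' t) (Icc a b) t) (ha : f a ≤ K)
    (h : ∀ t ∈ Icc a b, K < f t → f' t ≤ 0) : ∀ t ∈ Icc a b, f t ≤ K := by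
  intro r hr
  by_contra hlt
  push Not at hlt
  have hcont : ContinuousOn f (Icc a b) := fun t ht => (hf t ht).continuousWithinAt
  have hsub : Icc a r ⊆ Icc a b := Icc_subset_Icc_right hr.2
  have hcomp : IsCompact (Icc a r ∩ f ⁻¹' (Iic K)) :=
    ((hcont.mono hsub).preimage_isClosed_of_isClosed isClosed_Icc isClosed_Iic) |> fun hc =>
      isCompact_Icc.of_isClosed_subset hc inter_subset_left
  obtain ⟨s, ⟨hs1, hs2⟩, hmax⟩ := hcomp.exists_isGreatest ⟨a, ⟨le_refl _, hr.1⟩, ha⟩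
  have hsub2 : Icc s r ⊆ Icc a b := fun t ht => ⟨hs1.1.trans ht.1, ht.2.trans hr.2⟩
  have hanti : AntitoneOn f (Icc s r) := by
    apply antitoneOn_of_hasDerivWithinAt_nonpos (convex_Icc s r) (hcont.mono hsub2)
      (f' := f')
    · intro t ht
      exact (hf t (hsub2 (interior_subset ht))).mono (interior_subset.trans hsub2)
    · intro t ht
      have ht' := interior_subset ht
      rw [interior_Icc] at ht
      apply h t (hsub2 ht')
      by_contra hc
      push Not at hc
      have := hmax ⟨⟨hs1.1.trans ht'.1, ht'.2⟩, hc⟩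
      linarith [ht.1]
  have := hanti (left_mem_Icc.2 hs1.2) (right_mem_Icc.2 hs1.2) hs1.2
  have h2 : f s ≤ K := hs2
  linarith

lemma barrier_ge {f f' : ℝ → ℝ} {a b K : ℝ}
    (hf : ∀ t ∈ Icc a b, HasDerivWithinAt f (f' t) (Icc a b) t) (ha : K ≤ f a)
    (h : ∀ t ∈ Icc a b, f t < K → 0 ≤ f' t) : ∀ t ∈ Icc a b, K ≤ f t := by
  intro t ht
  have := barrier_le (f := fun t => - f t) (f' := fun t => - f' t) (K := -K)
    (fun t ht => (hf t ht).neg) (by linarith)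
    (fun t ht h' => by linarith [h t ht (by linarith)]) t ht
  linarith

/-- Abstract data for the desingularised equation with right-hand side `a h(u) - b u`. -/
structure BowlSetup (a b h U : ℝ → ℝ) : Prop where
  ca : ContinuousOn a (Ioi 0)
  cb : ContinuousOn b (Ioi 0)
  pa : ∀ r, 0 < r → 0 < a r
  pb : ∀ r, 0 < r → 0 < b r
  ch : ContinuousOn h (Icc 0 1)
  ah : AntitoneOn h (Icc 0 1)
  h0 : h 0 = 1
  h1 : 0 ≤ h 1
  lip : ∀ lo hi, 0 < lo → hi < 1 → ∃ K : NNReal, LipschitzOnWith K h (Icc lo hi)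
  mU : StrictMonoOn U (Ioi 0)
  U0 : ∀ r, 0 < r → 0 < U r
  U1 : ∀ r, 0 < r → U r < 1
  eq : ∀ r, 0 < r → a r * h (U r) = b r * U r
  lim : Tendsto U (𝓝[>] 0) (𝓝 0)

namespace BowlSetup

lemma anti {a b h U : ℝ → ℝ} (S : BowlSetup a b h U) {r u v : ℝ} (hr : 0 < r) (hu : 0 ≤ u) (huv : u ≤ v) (hv : v ≤ 1) :
    a r * h v - b r * v ≤ a r * h u - b r * u := by
  have h1 := S.ah ⟨hu, huv.trans hv⟩ ⟨hu.trans huv, hv⟩ huv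
  have h2 := mul_le_mul_of_nonneg_left h1 (S.pa r hr).le
  have h3 := mul_le_mul_of_nonneg_left huv (S.pb r hr).le
  linarith

lemma contraction {a b h U : ℝ → ℝ} (S : BowlSetup a b h U) {u v : ℝ → ℝ} {s t : ℝ} (hs : 0 < s)
    (hu : ∀ r ∈ Icc s t, HasDerivWithinAt u (a r * h (u r) - b r * u r) (Icc s t) r
      ∧ 0 ≤ u r ∧ u r ≤ 1)
    (hv : ∀ r ∈ Icc s t, HasDerivWithinAt v (a r * h (v r) - b r * v r) (Icc s t) r
      ∧ 0 ≤ v r ∧ v r ≤ 1) : ∀ r ∈ Icc s t, |u r - v r| ≤ |u s - v s| := by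
  intro r hr
  have hd : ∀ r ∈ Icc s t, HasDerivWithinAt (fun r => (u r - v r) ^ 2)
      (2 * (u r - v r) * ((a r * h (u r) - b r * u r) - (a r * h (v r) - b r * v r)))
      (Icc s t) r := by
    intro r hr
    have := ((hu r hr).1.sub (hv r hr).1).pow 2
    refine HasDerivWithinAt.congr_deriv this ?_
    simp
  have hanti : AntitoneOn (fun r => (u r - v r) ^ 2) (Icc s t) := by
    apply antitoneOn_of_hasDerivWithinAt_nonpos (convex_Icc s t)
      (fun r hr => (hd r hr).continuousWithinAt)
      (fun r hr => (hd r (interior_subset hr)).mono interior_subset)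
    intro r hr
    have hr' := interior_subset hr
    have hr0 : 0 < r := hs.trans_le hr'.1
    obtain ⟨-, u0, u1⟩ := hu r hr'
    obtain ⟨-, v0, v1⟩ := hv r hr'
    rcases le_total (u r) (v r) with hle | hle
    · have := S.anti hr0 u0 hle v1
      apply mul_nonpos_of_nonpos_of_nonneg <;> linarith
    · have := S.anti hr0 v0 hle u1
      apply mul_nonpos_of_nonneg_of_nonpos <;> linarith
  have := hanti (left_mem_Icc.2 (hr.1.trans hr.2)) hr hr.1
  exact sq_le_sq.1 this

lemma approx {a b h U : ℝ → ℝ} (S : BowlSetup a b h U) {ε T : ℝ} (hε : 0 < ε) (hT : ε < T) : ∃ u : ℝ → ℝ, ∀ r ∈ Icc ε T,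
    HasDerivWithinAt u (a r * h (u r) - b r * u r) (Icc ε T) r ∧ 0 ≤ u r ∧ u r ≤ U r := by
  have hT0 : 0 < T := hε.trans hT
  set lo := U ε / 2 with hlo
  set hi := U T with hhi
  have hUε := S.U0 ε hε
  have hUlt : U ε < U T := S.mU hε hT0 hT
  have hi1 : hi < 1 := S.U1 T hT0
  have lo0 : 0 < lo := by positivity
  have lohi : lo ≤ hi := by linarith
  set κ : ℝ → ℝ := fun x => max lo (min x hi) with hκ
  have κmem : ∀ x, κ x ∈ Icc lo hi := fun x => ⟨le_max_left _ _, max_le lohi (min_le_right _ _)⟩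
  have κmono : Monotone κ := fun x y hxy => max_le_max le_rfl (min_le_min hxy le_rfl)
  have κid : ∀ x ∈ Icc lo hi, κ x = x := fun x hx => by
    simp only [hκ]; rw [min_eq_left hx.2, max_eq_right hx.1]
  have κlip : LipschitzWith 1 κ := (LipschitzWith.id.min_const hi).const_max lo
  have κ01 : ∀ x, κ x ∈ Icc (0:ℝ) 1 := fun x => ⟨lo0.le.trans (κmem x).1, (κmem x).2.trans hi1.le⟩
  obtain ⟨K, hK⟩ := S.lip lo hi lo0 hi1
  have hIcc : Icc ε T ⊆ Ioi 0 := fun x hx => hε.trans_le hx.1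
  obtain ⟨Ma, hMa⟩ := isCompact_Icc.exists_bound_of_continuousOn (S.ca.mono hIcc)
  obtain ⟨Mb, hMb⟩ := isCompact_Icc.exists_bound_of_continuousOn (S.cb.mono hIcc)
  have Ma0 : 0 ≤ Ma := (norm_nonneg _).trans (hMa ε ⟨le_rfl, hT.le⟩)
  have Mb0 : 0 ≤ Mb := (norm_nonneg _).trans (hMb ε ⟨le_rfl, hT.le⟩)
  lift Ma to NNReal using Ma0
  lift Mb to NNReal using Mb0
  have hh : ∀ x ∈ Icc (0:ℝ) 1, |h x| ≤ 1 := by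
    intro x hx
    have e1 := S.ah ⟨le_rfl, zero_le_one⟩ hx hx.1
    have e2 := S.ah hx ⟨zero_le_one, le_rfl⟩ hx.2
    rw [S.h0] at e1
    have := S.h1
    rw [abs_le]; constructor <;> linarith
  have hPL : IsPicardLindelof (fun r x => a r * h (κ x) - b r * κ x)
      (⟨ε, le_rfl, hT.le⟩ : Icc ε T) lo ((Ma + Mb) * (T - ε).toNNReal) 0 (Ma + Mb) (Ma * K + Mb) := by
    constructor
    · intro t ht
      apply LipschitzOnWith.of_dist_le_mul
      intro x _ y _
      have e1 := hK.dist_le_mul _ (κmem x) _ (κmem y)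
      have e2 := κlip.dist_le_mul x y
      have e3 := hMa t ht
      have e4 := hMb t ht
      simp only [Real.dist_eq, Real.norm_eq_abs, NNReal.coe_one, one_mul] at e1 e2 e3 e4 ⊢
      have e5 : |h (κ x) - h (κ y)| ≤ K * |x - y| :=
        e1.trans (mul_le_mul_of_nonneg_left e2 K.2)
      calc |a t * h (κ x) - b t * κ x - (a t * h (κ y) - b t * κ y)|
          = |a t * (h (κ x) - h (κ y)) - b t * (κ x - κ y)| := by ring_nf
        _ ≤ |a t * (h (κ x) - h (κ y))| + |b t * (κ x - κ y)| := abs_sub _ _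
        _ ≤ Ma * (K * |x - y|) + Mb * |x - y| := by
            rw [abs_mul, abs_mul]; gcongr
        _ = _ := by push_cast; ring
    · intro x _
      exact ((S.ca.mono hIcc).mul continuousOn_const).sub ((S.cb.mono hIcc).mul continuousOn_const)
    · intro t ht x _
      have e3 := hMa t ht
      have e4 := hMb t ht
      have e5 := hh _ (κ01 x)
      have e6 : |κ x| ≤ 1 := by rw [abs_le]; constructor <;> linarith [(κ01 x).1, (κ01 x).2]
      simp only [Real.norm_eq_abs] at e3 e4 ⊢
      calc |a t * h (κ x) - b t * κ x| ≤ |a t * h (κ x)| + |b t * κ x| := abs_sub _ _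
        _ ≤ Ma * 1 + Mb * 1 := by rw [abs_mul, abs_mul]; gcongr
        _ = _ := by simp
    · simp only [sub_self, NNReal.coe_zero, sub_zero]
      rw [max_eq_left (by linarith)]
      push_cast
      rw [Real.coe_toNNReal _ (by linarith)]
  obtain ⟨u, hu0, hu⟩ := hPL.exists_eq_forall_mem_Icc_hasDerivWithinAt₀
  change u ε = lo at hu0
  have hlow : ∀ t ∈ Icc ε T, lo ≤ u t := by
    refine barrier_ge hu hu0.ge ?_
    intro t ht hlt
    have ht0 := hIcc ht
    have hk : κ (u t) = lo := le_antisymm ((κmono hlt.le).trans (κid lo ⟨le_rfl, lohi⟩).le)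
      (κmem _).1
    have hUt : U ε ≤ U t := S.mU.monotoneOn hε ht0 ht.1
    have := S.anti ht0 lo0.le (show lo ≤ U t by linarith) (S.U1 t ht0).le
    rw [S.eq t ht0, sub_self] at this
    simpa only [hk] using this
  have hup : ∀ t ∈ Icc ε T, u t ≤ U t := by
    intro r hr
    have hr0 := hIcc hr
    have hsub : Icc ε r ⊆ Icc ε T := Icc_subset_Icc_right hr.2
    have hUr : U ε ≤ U r := S.mU.monotoneOn hε hr0 hr.1
    have hUrT : U r ≤ U T := S.mU.monotoneOn hr0 hT0 hr.2
    refine barrier_le (fun t ht => (hu t (hsub ht)).mono hsub) (K := U r) ?_ ?_ r ⟨hr.1, le_rfl⟩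
    · rw [hu0]; linarith
    · intro t ht hlt
      have ht0 := hIcc (hsub ht)
      have hk : U r ≤ κ (u t) := by
        rw [← κid (U r) ⟨by linarith, hUrT⟩]; exact κmono hlt.le
      have hUt : U t ≤ U r := S.mU.monotoneOn ht0 hr0 ht.2
      have := S.anti ht0 (S.U0 t ht0).le (hUt.trans hk) (κ01 _).2
      rw [S.eq t ht0, sub_self] at this
      exact this
  refine ⟨u, fun r hr => ⟨?_, lo0.le.trans (hlow r hr), hup r hr⟩⟩
  have := hu r hr
  simp only [κid (u r) ⟨hlow r hr, (hup r hr).trans (S.mU.monotoneOn (hIcc hr) hT0 hr.2)⟩] at this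
  exact this

lemma exists_weak {a b h U : ℝ → ℝ} (S : BowlSetup a b h U) : ∃ u : ℝ → ℝ, ∀ r, 0 < r →
    HasDerivAt u (a r * h (u r) - b r * u r) r ∧ 0 ≤ u r ∧ u r ≤ U r := by
  set ε : ℕ → ℝ := fun k => 1 / ((k:ℝ) + 1) with hεd
  set T : ℕ → ℝ := fun k => (k:ℝ) + 2 with hTd
  have ε0 : ∀ k, 0 < ε k := fun k => Nat.one_div_pos_of_nat
  have εT : ∀ k, ε k < T k := fun k => by
    have : ε k ≤ 1 := by
      rw [hεd]; simp only; rw [div_le_one (by positivity)]; linarith [Nat.cast_nonneg (α := ℝ) k]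
    have h2 : (0:ℝ) ≤ k := Nat.cast_nonneg k
    simp only [hTd]; linarith
  have εanti : Antitone ε := fun k l hkl => Nat.one_div_le_one_div hkl
  have Tmono : Monotone T := fun k l hkl => by
    simp only [hTd]; have : (k:ℝ) ≤ l := Nat.cast_le.2 hkl
    linarith
  choose u hu using fun k => S.approx (ε0 k) (εT k)
  have εlim : Tendsto ε atTop (𝓝 0) := tendsto_one_div_add_atTop_nhds_zero_nat
  have Tlim : Tendsto T atTop atTop :=
    tendsto_atTop_add_const_right _ _ tendsto_natCast_atTop_atTop
  have Uεlim : Tendsto (fun k => U (ε k)) atTop (𝓝 0) :=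
    S.lim.comp (tendsto_nhdsWithin_iff.2 ⟨εlim, Eventually.of_forall ε0⟩)
  have hsub : ∀ k l, k ≤ l → Icc (ε k) (T k) ⊆ Icc (ε l) (T l) := fun k l hkl =>
    Icc_subset_Icc (εanti hkl) (Tmono hkl)
  have key : ∀ k l, k ≤ l → ∀ t ∈ Icc (ε k) (T k), |u k t - u l t| ≤ U (ε k) := by
    intro k l hkl t ht
    have h1 := S.contraction (u := u k) (v := u l) (ε0 k) (t := T k)
      (fun r hr => ⟨(hu k r hr).1, (hu k r hr).2.1,
        (hu k r hr).2.2.trans (S.U1 r ((ε0 k).trans_le hr.1)).le⟩)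
      (fun r hr => ⟨(hu l r (hsub k l hkl hr)).1.mono (hsub k l hkl), (hu l r (hsub k l hkl hr)).2.1,
        (hu l r (hsub k l hkl hr)).2.2.trans (S.U1 r ((ε0 k).trans_le hr.1)).le⟩) t ht
    refine h1.trans ?_
    have hm : ε k ∈ Icc (ε k) (T k) := ⟨le_rfl, (εT k).le⟩
    obtain ⟨-, p1, p2⟩ := hu k _ hm
    obtain ⟨-, p3, p4⟩ := hu l _ (hsub k l hkl hm)
    rw [abs_le]; constructor <;> linarith
  have ev : ∀ x y, 0 < x → ∀ᶠ k in atTop, Icc x y ⊆ Icc (ε k) (T k) := by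
    intro x y hx
    filter_upwards [εlim.eventually (gt_mem_nhds hx), Tlim.eventually_ge_atTop y] with k h1 h2
    exact Icc_subset_Icc h1.le h2
  have hconv : ∀ t, 0 < t → ∃ L, Tendsto (fun k => u k t) atTop (𝓝 L) := by
    intro t ht
    obtain ⟨N, hN⟩ := eventually_atTop.1 (ev t t ht)
    apply cauchySeq_tendsto_of_complete
    rw [Metric.cauchySeq_iff']
    intro e he
    obtain ⟨M, hM⟩ := eventually_atTop.1 (Uεlim.eventually (gt_mem_nhds he))
    refine ⟨max N M, fun k hk => ?_⟩
    rw [dist_comm, Real.dist_eq]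
    exact (key _ k hk t (hN _ (le_max_left _ _) ⟨le_rfl, le_rfl⟩)).trans_lt (hM _ (le_max_right _ _))
  choose! v hv using hconv
  have hvb : ∀ k, ∀ t ∈ Icc (ε k) (T k), |u k t - v t| ≤ U (ε k) := by
    intro k t ht
    have ht0 := (ε0 k).trans_le ht.1
    refine le_of_tendsto ((tendsto_const_nhds.sub (hv t ht0)).abs) ?_
    filter_upwards [eventually_ge_atTop k] with l hl
    exact key k l hl t ht
  have hv01 : ∀ t, 0 < t → 0 ≤ v t ∧ v t ≤ U t := by
    intro t ht
    constructor
    · refine ge_of_tendsto (hv t ht) ?_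
      filter_upwards [ev t t ht] with k hk
      exact (hu k t (hk ⟨le_rfl, le_rfl⟩)).2.1
    · refine le_of_tendsto (hv t ht) ?_
      filter_upwards [ev t t ht] with k hk
      exact (hu k t (hk ⟨le_rfl, le_rfl⟩)).2.2
  refine ⟨v, fun x hx => ⟨?_, hv01 x hx⟩⟩
  set I := Icc (x / 2) (x + 1) with hI
  have hI0 : I ⊆ Ioi 0 := fun t ht => lt_of_lt_of_le (by positivity) ht.1
  have hunif : TendstoUniformlyOn (fun k t => (t, u k t)) (fun t => (t, v t)) atTop I := by
    rw [Metric.tendstoUniformlyOn_iff]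
    intro e he
    filter_upwards [ev (x/2) (x+1) (by positivity), Uεlim.eventually (gt_mem_nhds he)] with k h1 h2
    intro t ht
    rw [Prod.dist_eq]
    simp only [dist_self]
    refine max_lt he ?_
    rw [dist_comm, Real.dist_eq]
    exact (hvb k t (h1 ht)).trans_lt h2
  have huc : UniformContinuousOn (fun p : ℝ × ℝ => a p.1 * h p.2 - b p.1 * p.2)
      (I ×ˢ Icc (0:ℝ) 1) := by
    apply IsCompact.uniformContinuousOn_of_continuous (isCompact_Icc.prod isCompact_Icc)
    have m1 : MapsTo (Prod.fst : ℝ × ℝ → ℝ) (I ×ˢ Icc (0:ℝ) 1) (Ioi 0) := fun p hp => hI0 hp.1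
    have m2 : MapsTo (Prod.snd : ℝ × ℝ → ℝ) (I ×ˢ Icc (0:ℝ) 1) (Icc 0 1) := fun p hp => hp.2
    exact ((S.ca.comp continuousOn_fst m1).mul (S.ch.comp continuousOn_snd m2)).sub
      ((S.cb.comp continuousOn_fst m1).mul continuousOn_snd)
  have hd := UniformContinuousOn.comp_tendstoUniformlyOn_eventually (F := fun k t => (t, u k t))
    (f := fun t => (t, v t)) (p := atTop) (t := I) (s := I ×ˢ Icc (0:ℝ) 1) ?_ ?_ huc hunif
  · refine hasDerivAt_of_tendstoUniformlyOn (s := Ioo (x/2) (x+1)) isOpen_Ioo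
      (l := atTop) (f := u) (hd.mono Ioo_subset_Icc_self) ?_ ?_ ⟨by linarith, by linarith⟩
    · filter_upwards [ev (x/2) (x+1) (by positivity)] with k hk
      intro t ht
      exact (hu k t (hk (Ioo_subset_Icc_self ht))).1.hasDerivAt
        (mem_of_superset (Icc_mem_nhds ht.1 ht.2) hk)
    · intro t ht
      exact hv t (hI0 (Ioo_subset_Icc_self ht))
  · filter_upwards [ev (x/2) (x+1) (by positivity)] with k hk
    intro t ht
    have := hu k t (hk ht)
    exact ⟨ht, this.2.1, this.2.2.trans (S.U1 t (hI0 ht)).le⟩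
  · intro t ht
    have := hv01 t (hI0 ht)
    exact ⟨ht, this.1, this.2.trans (S.U1 t (hI0 ht)).le⟩

lemma exists_sol {a b h U : ℝ → ℝ} (S : BowlSetup a b h U) : ∃ u : ℝ → ℝ, ∀ r, 0 < r →
    HasDerivAt u (a r * h (u r) - b r * u r) r ∧ 0 < u r ∧ u r < U r := by
  obtain ⟨u, hu⟩ := S.exists_weak
  have hmono : MonotoneOn u (Ioi 0) := by
    apply monotoneOn_of_hasDerivWithinAt_nonneg (convex_Ioi 0)
      (fun r hr => (hu r hr).1.continuousAt.continuousWithinAt)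
      (fun r hr => (hu r (interior_subset hr)).1.hasDerivWithinAt)
    intro r hr
    have hr0 : 0 < r := interior_subset hr
    have := S.anti hr0 (hu r hr0).2.1 (hu r hr0).2.2 (S.U1 r hr0).le
    rwa [S.eq r hr0, sub_self] at this
  have hpos : ∀ r, 0 < r → 0 < u r := by
    intro r hr
    by_contra hc
    have hz : ∀ t, 0 < t → t ≤ r → u t = 0 := fun t ht htr =>
      le_antisymm ((hmono ht hr htr).trans (not_lt.1 hc)) (hu t ht).2.1
    have hd := (hu (r/2) (by positivity)).1
    have hd0 : HasDerivAt u 0 (r/2) := by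
      refine (hasDerivAt_const (r/2) (0:ℝ)).congr_of_eventuallyEq ?_
      filter_upwards [Ioo_mem_nhds (show 0 < r/2 by positivity) (show r/2 < r by linarith)] with t ht
      exact hz t ht.1 ht.2.le
    have := hd.unique hd0
    rw [hz (r/2) (by positivity) (by linarith), S.h0] at this
    linarith [S.pa (r/2) (by positivity)]
  refine ⟨u, fun r hr => ⟨(hu r hr).1, hpos r hr, ?_⟩⟩
  refine lt_of_le_of_ne (hu r hr).2.2 fun heq => ?_
  set s := r / 2 with hs
  have hs0 : 0 < s := by positivity
  have hsr : s < r := by linarith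
  have hI0 : Icc s r ⊆ Ioi 0 := fun t ht => hs0.trans_le ht.1
  obtain ⟨K, hK⟩ := S.lip (u s) (U r) (hpos s hs0) (S.U1 r hr)
  obtain ⟨Ma, hMa⟩ := isCompact_Icc.exists_bound_of_continuousOn (S.ca.mono hI0)
  obtain ⟨Mb, hMb⟩ := isCompact_Icc.exists_bound_of_continuousOn (S.cb.mono hI0)
  set L := Ma * K + Mb with hL
  have hd : ∀ t ∈ Icc s r, HasDerivAt (fun t => (U r - u t) * exp (L * t))
      ((- (a t * h (u t) - b t * u t)) * exp (L * t) + (U r - u t) * (exp (L * t) * L)) t := by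
    intro t ht
    have e1 := (hu t (hI0 ht)).1.const_sub (U r)
    have e2 : HasDerivAt (fun t => exp (L * t)) (exp (L * t) * L) t := by
      simpa using ((hasDerivAt_id t).const_mul L).exp
    exact e1.mul e2
  have hm : MonotoneOn (fun t => (U r - u t) * exp (L * t)) (Icc s r) := by
    apply monotoneOn_of_hasDerivWithinAt_nonneg (convex_Icc s r)
      (fun t ht => (hd t ht).continuousAt.continuousWithinAt)
      (fun t ht => (hd t (interior_subset ht)).hasDerivWithinAt)
    intro t ht
    have ht := interior_subset ht
    have ht0 : 0 < t := hI0 ht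
    have hut : u t ≤ U r := (hu t ht0).2.2.trans (S.mU.monotoneOn ht0 hr ht.2)
    have hst : u s ≤ u t := hmono hs0 ht0 ht.1
    have e1 := hK.dist_le_mul (u t) ⟨hst, hut⟩ (U r) ⟨hst.trans hut, le_rfl⟩
    have e3 := hMa t ht
    have e4 := hMb t ht
    simp only [Real.dist_eq, Real.norm_eq_abs] at e1 e3 e4
    rw [abs_sub_comm (u t), abs_of_nonneg (sub_nonneg.2 hut)] at e1
    have e5 := S.anti ht0 (S.U0 t ht0).le (S.mU.monotoneOn ht0 hr ht.2) (S.U1 r hr).le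
    rw [S.eq t ht0, sub_self] at e5
    have e6 : a t * (h (u t) - h (U r)) ≤ Ma * (K * (U r - u t)) :=
      mul_le_mul ((le_abs_self _).trans e3) ((le_abs_self _).trans e1)
        (sub_nonneg.2 (S.ah ⟨(hu t ht0).2.1, hut.trans (S.U1 r hr).le⟩
          ⟨(S.U0 r hr).le, (S.U1 r hr).le⟩ hut)) ((abs_nonneg _).trans e3)
    have e7 : b t * (U r - u t) ≤ Mb * (U r - u t) :=
      mul_le_mul_of_nonneg_right ((le_abs_self _).trans e4) (sub_nonneg.2 hut)
    have e8 : 0 ≤ - (a t * h (u t) - b t * u t) + (U r - u t) * L := by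
      rw [hL]; nlinarith
    have := mul_nonneg e8 (exp_pos (L * t)).le
    linarith
  have h1 := hm (left_mem_Icc.2 hsr.le) (right_mem_Icc.2 hsr.le) hsr.le
  simp only [heq, sub_self, zero_mul] at h1
  have h2 : u s < U r := (hu s hs0).2.2.trans_lt (S.mU hs0 hr hsr)
  have := mul_pos (sub_pos.2 h2) (exp_pos (L * s))
  linarith

lemma uniq {a b h U : ℝ → ℝ} (S : BowlSetup a b h U) {u v : ℝ → ℝ}
    (hu : ∀ r, 0 < r → HasDerivAt u (a r * h (u r) - b r * u r) r ∧ 0 ≤ u r ∧ u r ≤ U r)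
    (hv : ∀ r, 0 < r → HasDerivAt v (a r * h (v r) - b r * v r) r ∧ 0 ≤ v r ∧ v r ≤ U r) :
    ∀ r, 0 < r → u r = v r := by
  intro r hr
  have hle : |u r - v r| ≤ 0 := by
    refine ge_of_tendsto S.lim ?_
    filter_upwards [Ioo_mem_nhdsGT hr] with s hs
    have := S.contraction (u := u) (v := v) hs.1 (t := r)
      (fun t ht => have h0 := hs.1.trans_le ht.1
        ⟨(hu t h0).1.hasDerivWithinAt, (hu t h0).2.1, (hu t h0).2.2.trans (S.U1 t h0).le⟩)
      (fun t ht => have h0 := hs.1.trans_le ht.1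
        ⟨(hv t h0).1.hasDerivWithinAt, (hv t h0).2.1, (hv t h0).2.2.trans (S.U1 t h0).le⟩)
      r ⟨hs.2.le, le_rfl⟩
    refine this.trans ?_
    obtain ⟨-, p1, p2⟩ := hu s hs.1
    obtain ⟨-, p3, p4⟩ := hv s hs.1
    rw [abs_le]; constructor <;> linarith
  have := abs_nonpos_iff.1 hle
  linarith

end BowlSetup

lemma bowl_to_u {z : ℝ → ℝ} {r P C S μ k G : ℝ} (hμ : 0 < μ) (hz0 : 0 < z r) (hz1 : z r < 1)
    (hG : G = P * ((1 - z r ^ 2) / z r) * (S - C * z r ^ k * (1 - z r ^ 2) ^ (-μ)))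
    (hd : HasDerivAt z G r) :
    HasDerivAt (fun t => (1 - z t ^ 2) ^ μ)
      (2 * μ * P * C * (1 - ((1 - z r ^ 2) ^ μ) ^ (1 / μ)) ^ (k / 2)
        - 2 * μ * P * S * (1 - z r ^ 2) ^ μ) r := by
  have hw : 0 < 1 - z r ^ 2 := by nlinarith
  have h1 : HasDerivAt (fun t => 1 - z t ^ 2) (-(2 * z r * G)) r := by
    have := (hd.pow 2).const_sub 1
    refine HasDerivAt.congr_deriv this ?_
    simp
  have h2 := h1.rpow_const (p := μ) (Or.inl hw.ne')
  refine HasDerivAt.congr_deriv h2 ?_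
  have e1 : ((1 - z r ^ 2) ^ μ) ^ (1 / μ) = 1 - z r ^ 2 := by
    rw [← rpow_mul hw.le, mul_one_div_cancel hμ.ne', rpow_one]
  have e2 : (1 - (1 - z r ^ 2)) ^ (k / 2) = z r ^ k := by
    rw [sub_sub_cancel, ← rpow_natCast, ← rpow_mul hz0.le]; congr 1; push_cast; ring
  rw [e1, e2, hG, rpow_sub_one hw.ne', rpow_neg hw.le]
  have hu : (1 - z r ^ 2) ^ μ ≠ 0 := (rpow_pos_of_pos hw μ).ne'
  field_simp
  ring

lemma bowl_to_y {u : ℝ → ℝ} {r P C S μ k : ℝ} (hμ : 0 < μ) (hu0 : 0 < u r) (hu1 : u r < 1)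
    (hd : HasDerivAt u (2 * μ * P * C * (1 - u r ^ (1 / μ)) ^ (k / 2) - 2 * μ * P * S * u r) r) :
    HasDerivAt (fun t => √(1 - u t ^ (1 / μ)))
      (P * ((1 - √(1 - u r ^ (1 / μ)) ^ 2) / √(1 - u r ^ (1 / μ))) *
        (S - C * √(1 - u r ^ (1 / μ)) ^ k * (1 - √(1 - u r ^ (1 / μ)) ^ 2) ^ (-μ))) r := by
  have hw1 : u r ^ (1 / μ) < 1 := rpow_lt_one hu0.le hu1 (by positivity)
  have hw : 0 < 1 - u r ^ (1 / μ) := by linarith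
  have h1 := (((hd.rpow_const (p := 1 / μ) (Or.inl hu0.ne')).const_sub 1).sqrt hw.ne')
  refine HasDerivAt.congr_deriv h1 ?_
  have e1 : √(1 - u r ^ (1 / μ)) ^ k = (1 - u r ^ (1 / μ)) ^ (k / 2) := by
    rw [sqrt_eq_rpow, ← rpow_mul hw.le]; congr 1; ring
  have e2 : (u r ^ (1 / μ)) ^ (-μ) = (u r)⁻¹ := by
    rw [← rpow_mul hu0.le, show 1 / μ * -μ = -1 by field_simp, rpow_neg_one]
  have hy : √(1 - u r ^ (1 / μ)) ≠ 0 := (sqrt_pos.2 hw).ne'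
  rw [e1, sq_sqrt hw.le, sub_sub_cancel, e2, rpow_sub_one hu0.ne']
  field_simp
  ring

lemma bowl_h_props {μ k : ℝ} (hμ : 0 < μ) (hk : 0 < k) :
    Continuous (fun u : ℝ => (1 - u ^ (1 / μ)) ^ (k / 2)) ∧
    AntitoneOn (fun u : ℝ => (1 - u ^ (1 / μ)) ^ (k / 2)) (Icc 0 1) ∧
    ∀ lo hi, 0 < lo → hi < 1 → ∃ K : NNReal,
      LipschitzOnWith K (fun u : ℝ => (1 - u ^ (1 / μ)) ^ (k / 2)) (Icc lo hi) := by
  refine ⟨?_, ?_, ?_⟩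
  · have h1 : Continuous (fun u : ℝ => u ^ (1 / μ)) :=
      continuous_id.rpow_const fun _ => Or.inr (by positivity)
    exact (continuous_const.sub h1).rpow_const fun _ => Or.inr (by positivity)
  · intro x hx y hy hxy
    have h1 : x ^ (1 / μ) ≤ y ^ (1 / μ) := rpow_le_rpow hx.1 hxy (by positivity)
    have h2 : y ^ (1 / μ) ≤ 1 := rpow_le_one hy.1 hy.2 (by positivity)
    exact rpow_le_rpow (by linarith) (by linarith) (by positivity)
  · intro lo hi hlo hhi
    have : ContDiffOn ℝ 1 (fun u : ℝ => (1 - u ^ (1 / μ)) ^ (k / 2)) (Icc lo hi) := by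
      intro x hx
      have hx0 : 0 < x := hlo.trans_le hx.1
      have hx1 : x ^ (1 / μ) < 1 := rpow_lt_one hx0.le (hx.2.trans_lt hhi) (by positivity)
      have c1 : ContDiffAt ℝ 1 (fun u : ℝ => u ^ (1 / μ)) x :=
        contDiffAt_id.rpow_const_of_ne hx0.ne'
      exact ((contDiffAt_const.sub c1).rpow_const_of_ne (by linarith)).contDiffWithinAt
    exact this.exists_lipschitzOnWith one_ne_zero (convex_Icc _ _) isCompact_Icc

/-- Existence and uniqueness of the bowl-type soliton: there is a
unique continuous `y : [0,∞) → (0,1]` with `y(0) = 1`, differentiable on `(0,∞)`,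
solving `y' = G(r, y)` and satisfying `Γ(r) < y(r) < 1` for all `r > 0`. -/
theorem stmt10 (n m : ℕ) (hn : 3 ≤ n) (hm : 2 ≤ m) (hmn : m < n)
    (α c : ℝ) (hα : α = 1 ∨ α = 1 / m) (hc : 0 < c)
    (ξ χ ξ' χ' qξ qχ : ℝ → ℝ)
    (hξd : ∀ r ∈ Set.Ioi (0 : ℝ), HasDerivAt ξ (ξ' r) r)
    (hχd : ∀ r ∈ Set.Ioi (0 : ℝ), HasDerivAt χ (χ' r) r)
    (hξC2 : ContDiffOn ℝ 1 ξ' (Set.Ioi 0)) (hχC2 : ContDiffOn ℝ 1 χ' (Set.Ioi 0))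
    (hξpos : ∀ r ∈ Set.Ioi (0 : ℝ), 0 < ξ r)
    (hξ'pos : ∀ r ∈ Set.Ioi (0 : ℝ), 0 < ξ' r)
    (hχpos : ∀ r ∈ Set.Ioi (0 : ℝ), 0 < χ r)
    (hχmono : MonotoneOn χ (Set.Ioi 0))
    (hq1pos : ∀ r ∈ Set.Ioi (0 : ℝ), 0 < ξ' r / ξ r)
    (hq1 : StrictAntiOn (fun r => ξ' r / ξ r) (Set.Ioi 0))
    (hq2 : AntitoneOn (fun r => ξ' r * χ' r / (ξ r * χ r)) (Set.Ioi 0))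
    (hqξd : ∀ r ∈ Set.Ioi (0 : ℝ), HasDerivAt (fun t => ξ' t / ξ t) (qξ r) r)
    (hqχd : ∀ r ∈ Set.Ioi (0 : ℝ), HasDerivAt (fun t => χ' t / χ t) (qχ r) r)
    (hξas1 : (fun r => ξ' r / ξ r - 1 / r) =O[𝓝[>] (0 : ℝ)] fun r => r)
    (hξas2 : (fun r => qξ r + 1 / r ^ 2) =O[𝓝[>] (0 : ℝ)] fun _ => (1 : ℝ))
    (hχas1 : (fun r => χ' r / χ r) =O[𝓝[>] (0 : ℝ)] fun r => r)
    (hχas2 : qχ =O[𝓝[>] (0 : ℝ)] fun _ => (1 : ℝ))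
    (hχlim : Tendsto χ (𝓝[>] (0 : ℝ)) (𝓝 1))
    (Γ : ℝ → ℝ)
    (hΓ : ∀ r ∈ Set.Ioi (0 : ℝ), Γ r ∈ Set.Ioo (0 : ℝ) 1 ∧
      Γ r ^ (1 / α) * (1 - Γ r ^ 2) ^ (-(m : ℝ) / 2) =
        cylSm n m ξ ξ' χ χ' r / (c * χ r) ^ (1 / α)) :
    ∃ y : ℝ → ℝ,
      (ContinuousOn y (Set.Ici 0) ∧ (∀ r ∈ Set.Ici (0 : ℝ), y r ∈ Set.Ioc (0 : ℝ) 1) ∧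
        y 0 = 1 ∧
        ∀ r ∈ Set.Ioi (0 : ℝ),
          HasDerivAt y (solitonG n m α c ξ ξ' χ χ' r (y r)) r ∧ Γ r < y r ∧ y r < 1) ∧
      ∀ z : ℝ → ℝ,
        (ContinuousOn z (Set.Ici 0) ∧ (∀ r ∈ Set.Ici (0 : ℝ), z r ∈ Set.Ioc (0 : ℝ) 1) ∧
          z 0 = 1 ∧
          ∀ r ∈ Set.Ioi (0 : ℝ),
            HasDerivAt z (solitonG n m α c ξ ξ' χ χ' r (z r)) r ∧ Γ r < z r ∧ z r < 1) →
        ∀ r ∈ Set.Ici (0 : ℝ), z r = y r := by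
  have hA : (0:ℝ) < ((n - 1).choose (m - 1) : ℝ) := by
    exact_mod_cast Nat.choose_pos (by omega)
  have hB : (0:ℝ) < ((n - 1).choose m : ℝ) := by
    exact_mod_cast Nat.choose_pos (by omega)
  have hm0 : (0:ℝ) < m := by exact_mod_cast (by omega : 0 < m)
  have hk : 0 < 1 / α := by
    rcases hα with rfl | rfl
    · norm_num
    · positivity
  set k := 1 / α with hkdef
  clear_value k
  set μ : ℝ := (m:ℝ) / 2 with hμdef
  have hμ : 0 < μ := by positivity
  have hμ2 : 2 * μ = m := by rw [hμdef]; ring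
  have hnegμ : -(m:ℝ) / 2 = -μ := by rw [hμdef]; ring
  have hχ'0 : ∀ r, 0 < r → 0 ≤ χ' r := by
    intro r hr
    have h1 : derivWithin χ (Ioi 0) r = χ' r :=
      (hχd r hr).hasDerivWithinAt.derivWithin (isOpen_Ioi.uniqueDiffWithinAt hr)
    rw [← h1]
    exact hχmono.derivWithin_nonneg
  have hSpos : ∀ r, 0 < r → ((n - 1).choose m : ℝ) * (ξ' r / ξ r) ^ m ≤ cylSm n m ξ ξ' χ χ' r := by
    intro r hr
    have h1 : 0 ≤ χ' r / χ r := div_nonneg (hχ'0 r hr) (hχpos r hr).le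
    have h2 := hq1pos r hr
    have h3 : (ξ' r / ξ r) ^ m = (ξ' r / ξ r) * (ξ' r / ξ r) ^ (m - 1) := by
      rw [← pow_succ']; congr 1; omega
    unfold cylSm
    rw [h3, ← mul_assoc]
    apply mul_le_mul_of_nonneg_right _ (by positivity)
    have := mul_nonneg hA.le h1
    linarith
  have hS0 : ∀ r, 0 < r → 0 < cylSm n m ξ ξ' χ χ' r := fun r hr =>
    lt_of_lt_of_le (by have := hq1pos r hr; positivity) (hSpos r hr)
  have hSform : ∀ r, cylSm n m ξ ξ' χ χ' r =
      ((n - 1).choose (m - 1) : ℝ) * ((ξ' r * χ' r / (ξ r * χ r)) * (ξ' r / ξ r) ^ (m - 2)) +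
      ((n - 1).choose m : ℝ) * (ξ' r / ξ r) ^ m := by
    intro r
    obtain ⟨l, rfl⟩ : ∃ l, m = l + 2 := ⟨m - 2, by omega⟩
    unfold cylSm
    simp only [show l + 2 - 1 = l + 1 by omega, show l + 2 - 2 = l by omega]
    rw [mul_div_mul_comm]
    ring
  have hSanti : StrictAntiOn (cylSm n m ξ ξ' χ χ') (Ioi 0) := by
    intro r hr s hs hrs
    have hr' : 0 < r := hr
    have hs' : 0 < s := hs
    rw [hSform r, hSform s]
    have p0 := hq1pos s hs
    have p1 : ξ' s / ξ s < ξ' r / ξ r := hq1 hr hs hrs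
    have p2 : ξ' s * χ' s / (ξ s * χ s) ≤ ξ' r * χ' r / (ξ r * χ r) := hq2 hr hs hrs.le
    have p3 : 0 ≤ ξ' r * χ' r / (ξ r * χ r) :=
      div_nonneg (mul_nonneg (hξ'pos r hr).le (hχ'0 r hr)) (mul_pos (hξpos r hr) (hχpos r hr)).le
    have p4 : (ξ' s / ξ s) ^ (m - 2) ≤ (ξ' r / ξ r) ^ (m - 2) := pow_le_pow_left₀ p0.le p1.le _
    have p5 : (ξ' s / ξ s) ^ m < (ξ' r / ξ r) ^ m := pow_lt_pow_left₀ p1 p0.le (by omega)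
    have p6 := mul_le_mul p2 p4 (by positivity) p3
    have p7 := mul_le_mul_of_nonneg_left p6 hA.le
    have p8 := mul_lt_mul_of_pos_left p5 hB
    linarith
  have hC0 : ∀ r, 0 < r → 0 < (c * χ r) ^ k := fun r hr =>
    rpow_pos_of_pos (mul_pos hc (hχpos r hr)) k
  have hP0 : ∀ r, 0 < r → 0 < (((n - 1).choose (m - 1) : ℝ))⁻¹ * (ξ r / ξ' r) ^ (m - 1) := by
    intro r hr
    have := hξpos r hr
    have := hξ'pos r hr
    positivity
  obtain ⟨hch, hah, hlip⟩ := bowl_h_props hμ hk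
  have hw0 : ∀ r, 0 < r → 0 < 1 - Γ r ^ 2 := by
    intro r hr
    have := (hΓ r hr).1.1
    have := (hΓ r hr).1.2
    nlinarith
  have hU0 : ∀ r, 0 < r → 0 < (1 - Γ r ^ 2) ^ μ := fun r hr => rpow_pos_of_pos (hw0 r hr) μ
  have hU1 : ∀ r, 0 < r → (1 - Γ r ^ 2) ^ μ < 1 := fun r hr =>
    rpow_lt_one (hw0 r hr).le (by have := (hΓ r hr).1.1; nlinarith) hμ
  have hUi : ∀ r, 0 < r → ((1 - Γ r ^ 2) ^ μ) ^ (1 / μ) = 1 - Γ r ^ 2 := by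
    intro r hr
    rw [← rpow_mul (hw0 r hr).le, mul_one_div_cancel hμ.ne', rpow_one]
  have hUh : ∀ r, 0 < r → (1 - ((1 - Γ r ^ 2) ^ μ) ^ (1 / μ)) ^ (k / 2) = Γ r ^ k := by
    intro r hr
    rw [hUi r hr, sub_sub_cancel, ← rpow_natCast, ← rpow_mul (hΓ r hr).1.1.le]
    congr 1; push_cast; ring
  have hUeq : ∀ r, 0 < r → Γ r ^ k * (c * χ r) ^ k =
      cylSm n m ξ ξ' χ χ' r * (1 - Γ r ^ 2) ^ μ := by
    intro r hr
    have h1 := (hΓ r hr).2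
    rw [hnegμ, rpow_neg (hw0 r hr).le] at h1
    have h2 := (hC0 r hr).ne'
    have h3 := (hU0 r hr).ne'
    field_simp at h1
    linarith
  have hUmono : StrictMonoOn (fun r => (1 - Γ r ^ 2) ^ μ) (Ioi 0) := by
    intro r hr s hs hrs
    by_contra hcon
    simp only [not_lt] at hcon
    have e1 := hUeq r hr
    have e2 := hUeq s hs
    have e3 := hah ⟨(hU0 s hs).le, (hU1 s hs).le⟩ ⟨(hU0 r hr).le, (hU1 r hr).le⟩ hcon
    simp only [hUh r hr, hUh s hs] at e3
    have e4 : (c * χ r) ^ k ≤ (c * χ s) ^ k :=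
      rpow_le_rpow (mul_pos hc (hχpos r hr)).le
        (mul_le_mul_of_nonneg_left (hχmono hr hs hrs.le) hc.le) hk.le
    have e5 := mul_le_mul e3 e4 (hC0 r hr).le (rpow_nonneg (hΓ s hs).1.1.le k)
    have e6 := mul_lt_mul_of_pos_right (hSanti hr hs hrs) (hU0 s hs)
    have e7 := mul_le_mul_of_nonneg_left hcon (hS0 r hr).le
    linarith
  have hplim : Tendsto (fun r => ξ' r / ξ r) (𝓝[>] (0:ℝ)) atTop := by
    have h1 : Tendsto (fun r => ξ' r / ξ r - 1 / r) (𝓝[>] (0:ℝ)) (𝓝 0) :=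
      hξas1.trans_tendsto (tendsto_nhdsWithin_of_tendsto_nhds tendsto_id)
    have h2 := tendsto_inv_nhdsGT_zero (𝕜 := ℝ) |>.atTop_add h1
    refine h2.congr fun r => ?_
    simp
  have hSlim : Tendsto (cylSm n m ξ ξ' χ χ') (𝓝[>] (0:ℝ)) atTop := by
    have h1 : Tendsto (fun r => ((n - 1).choose m : ℝ) * (ξ' r / ξ r) ^ m) (𝓝[>] (0:ℝ)) atTop :=
      ((tendsto_pow_atTop (by omega : m ≠ 0)).comp hplim).const_mul_atTop hB
    refine tendsto_atTop_mono' _ ?_ h1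
    filter_upwards [self_mem_nhdsWithin] with r hr
    exact hSpos r hr
  have hUlim : Tendsto (fun r => (1 - Γ r ^ 2) ^ μ) (𝓝[>] (0:ℝ)) (𝓝 0) := by
    have h1 : Tendsto (fun r => (c * χ r) ^ k) (𝓝[>] (0:ℝ)) (𝓝 ((c * 1) ^ k)) :=
      (hχlim.const_mul c).rpow_const (Or.inr hk.le)
    have h2 := h1.div_atTop hSlim
    refine tendsto_of_tendsto_of_tendsto_of_le_of_le' tendsto_const_nhds h2 ?_ ?_
    · filter_upwards [self_mem_nhdsWithin] with r hr
      exact (hU0 r hr).le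
    · filter_upwards [self_mem_nhdsWithin] with r hr
      rw [le_div_iff₀ (hS0 r hr), mul_comm, ← hUeq r hr]
      have : Γ r ^ k ≤ 1 := rpow_le_one (hΓ r hr).1.1.le (hΓ r hr).1.2.le hk.le
      have := mul_le_mul_of_nonneg_right this (hC0 r hr).le
      linarith
  have cξ : ContinuousOn ξ (Ioi 0) := fun r hr => (hξd r hr).continuousAt.continuousWithinAt
  have cχ : ContinuousOn χ (Ioi 0) := fun r hr => (hχd r hr).continuousAt.continuousWithinAt
  have cξ' := hξC2.continuousOn
  have cχ' := hχC2.continuousOn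
  have cP : ContinuousOn (fun r => (((n - 1).choose (m - 1) : ℝ))⁻¹ * (ξ r / ξ' r) ^ (m - 1))
      (Ioi 0) :=
    continuousOn_const.mul ((cξ.div cξ' fun r hr => (hξ'pos r hr).ne').pow _)
  have cC : ContinuousOn (fun r => (c * χ r) ^ k) (Ioi 0) :=
    (continuousOn_const.mul cχ).rpow_const fun _ _ => Or.inr hk.le
  have cS : ContinuousOn (cylSm n m ξ ξ' χ χ') (Ioi 0) := by
    have c1 := cξ'.div cξ fun r hr => (hξpos r hr).ne'
    have c2 := cχ'.div cχ fun r hr => (hχpos r hr).ne'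
    exact ((continuousOn_const.mul c2).add (continuousOn_const.mul c1)).mul (c1.pow _)
  set P : ℝ → ℝ := fun r => (((n - 1).choose (m - 1) : ℝ))⁻¹ * (ξ r / ξ' r) ^ (m - 1) with hPdef
  have S : BowlSetup (fun r => 2 * μ * P r * (c * χ r) ^ k)
      (fun r => 2 * μ * P r * cylSm n m ξ ξ' χ χ' r)
      (fun u : ℝ => (1 - u ^ (1 / μ)) ^ (k / 2)) (fun r => (1 - Γ r ^ 2) ^ μ) :=
    { ca := (continuousOn_const.mul cP).mul cC
      cb := (continuousOn_const.mul cP).mul cS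
      pa := fun r hr => by
        have := hP0 r hr
        have := hC0 r hr
        positivity
      pb := fun r hr => by
        have := hP0 r hr
        have := hS0 r hr
        positivity
      ch := hch.continuousOn
      ah := hah
      h0 := by
        rw [zero_rpow (by positivity), sub_zero, one_rpow]
      h1 := by
        rw [one_rpow, sub_self, zero_rpow (by positivity)]
      lip := hlip
      mU := hUmono
      U0 := hU0
      U1 := hU1
      eq := fun r hr => by
        rw [hUh r hr]
        linear_combination 2 * μ * P r * hUeq r hr
      lim := hUlim }
  have hGform : ∀ r y, solitonG n m α c ξ ξ' χ χ' r y = P r * ((1 - y ^ 2) / y) *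
      (cylSm n m ξ ξ' χ χ' r - (c * χ r) ^ k * y ^ k * (1 - y ^ 2) ^ (-μ)) := by
    intro r y
    unfold solitonG
    rw [← hkdef, hnegμ]
  obtain ⟨u, hu⟩ := S.exists_sol
  set v : ℝ → ℝ := fun r => if r ≤ 0 then 0 else u r with hv
  have hv0 : v 0 = 0 := by simp [hv]
  have hvu : ∀ r, 0 < r → v r = u r := fun r hr => by simp [hv, not_le.2 hr]
  have hvev : ∀ r, 0 < r → v =ᶠ[𝓝 r] u := fun r hr => by
    filter_upwards [lt_mem_nhds hr] with t ht
    exact hvu t ht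
  have hvs : ∀ r, 0 < r → HasDerivAt v (2 * μ * P r * (c * χ r) ^ k *
      (1 - v r ^ (1 / μ)) ^ (k / 2) - 2 * μ * P r * cylSm n m ξ ξ' χ χ' r * v r) r ∧
      0 < v r ∧ v r < (1 - Γ r ^ 2) ^ μ := by
    intro r hr
    rw [hvu r hr]
    exact ⟨(hu r hr).1.congr_of_eventuallyEq (hvev r hr), (hu r hr).2⟩
  have hvc : ContinuousOn v (Ici 0) := by
    intro r hr
    rcases (mem_Ici.1 hr).eq_or_lt with h0 | h0
    · subst h0
      rw [← Ioi_insert, continuousWithinAt_insert_self]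
      change Tendsto v (𝓝[>] 0) (𝓝 (v 0))
      rw [hv0]
      refine tendsto_of_tendsto_of_tendsto_of_le_of_le' tendsto_const_nhds hUlim ?_ ?_
      · filter_upwards [self_mem_nhdsWithin] with t ht
        exact (hvs t ht).2.1.le
      · filter_upwards [self_mem_nhdsWithin] with t ht
        exact (hvs t ht).2.2.le
    · exact (hvs r h0).1.continuousAt.continuousWithinAt
  have hyΓ : ∀ r, 0 < r → v r ^ (1 / μ) < 1 - Γ r ^ 2 := by
    intro r hr
    rw [← hUi r hr]
    exact rpow_lt_rpow (hvs r hr).2.1.le (hvs r hr).2.2 (by positivity)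
  have hmain : ∀ r, 0 < r → Γ r < √(1 - v r ^ (1 / μ)) ∧ √(1 - v r ^ (1 / μ)) < 1 := by
    intro r hr
    constructor
    · apply lt_sqrt_of_sq_lt
      linarith [hyΓ r hr]
    · rw [sqrt_lt' one_pos]
      have := rpow_pos_of_pos (hvs r hr).2.1 (1 / μ)
      linarith
  have hy0 : √(1 - v 0 ^ (1 / μ)) = 1 := by
    rw [hv0, zero_rpow (by positivity), sub_zero, sqrt_one]
  refine ⟨fun r => √(1 - v r ^ (1 / μ)), ⟨?_, ?_, hy0, ?_⟩, ?_⟩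
  · exact (continuousOn_const.sub (hvc.rpow_const fun _ _ => Or.inr (by positivity))).sqrt
  · intro r hr
    rcases (mem_Ici.1 hr).eq_or_lt with h0 | h0
    · subst h0
      simp only [hy0]
      exact ⟨one_pos, le_rfl⟩
    · exact ⟨(hΓ r h0).1.1.trans (hmain r h0).1, (hmain r h0).2.le⟩
  · intro r hr
    refine ⟨?_, hmain r hr⟩
    rw [hGform]
    exact bowl_to_y hμ (hvs r hr).2.1 ((hvs r hr).2.2.trans (hU1 r hr)) (hvs r hr).1
  · rintro z ⟨-, hz, hz0, hzs⟩ r hr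
    rcases (mem_Ici.1 hr).eq_or_lt with h0 | h0
    · subst h0
      rw [hz0]; exact hy0.symm
    · have key := S.uniq (u := fun t => (1 - z t ^ 2) ^ μ) (v := v) ?_ ?_ r h0
      · simp only at key ⊢
        have hzr := hzs r h0
        have hzp := (hΓ r h0).1.1.trans hzr.2.1
        have hw : 0 < 1 - z r ^ 2 := by nlinarith [hzr.2.2]
        rw [← key, ← rpow_mul hw.le, mul_one_div_cancel hμ.ne', rpow_one, sub_sub_cancel,
          sqrt_sq hzp.le]
      · intro t ht
        obtain ⟨d1, d2, d3⟩ := hzs t ht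
        have hΓp := (hΓ t ht).1.1
        have hzp := hΓp.trans d2
        have hw : 0 < 1 - z t ^ 2 := by nlinarith
        refine ⟨bowl_to_u hμ hzp d3 (hGform t (z t)) d1, (rpow_pos_of_pos hw μ).le, ?_⟩
        exact rpow_le_rpow hw.le (by nlinarith) hμ.le
      · intro t ht
        exact ⟨(hvs t ht).1, (hvs t ht).2.1.le, (hvs t ht).2.2.le⟩
end

section
/- Under the hypotheses of the bowl-soliton existence statement (n ≥ 3, 2 ≤ m < n, α ∈ {1, 1/m}, c > 0, ξ, χ twice continuously differentiable positive with the structural monotonicity conditions and the expansions ξ'/ξ = 1/r + O(r), (ξ'/ξ)' = −1/r² + O(1), χ'/χ = O(r), (χ'/χ)' = O(1), χ(r) → 1 as r → 0⁺), the unique solution y : [0, ∞) → (0, 1] of y' = G(r, y) with y(0) = 1 satisfies lim_{r→0⁺} (1 − y(r))/r² = (1/2) c^{2/(mα)} C(n, m)^{−2/m}, where C(n, m) is the binomial coefficient. -/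
open Real Set Filter Topology Asymptotics

/-- The bowl-type soliton solution `y` of `y' = G(r, y)` with
`y(0) = 1` satisfies `(1 - y(r))/r² → (1/2) c^{2/(mα)} C(n,m)^{-2/m}` as `r → 0⁺`. -/
theorem stmt11 (n m : ℕ) (hn : 3 ≤ n) (hm : 2 ≤ m) (hmn : m < n)
    (α c : ℝ) (hα : α = 1 ∨ α = 1 / m) (hc : 0 < c)
    (ξ χ ξ' χ' qξ qχ : ℝ → ℝ)
    (hξd : ∀ r ∈ Set.Ioi (0 : ℝ), HasDerivAt ξ (ξ' r) r)
    (hχd : ∀ r ∈ Set.Ioi (0 : ℝ), HasDerivAt χ (χ' r) r)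
    (hξC2 : ContDiffOn ℝ 1 ξ' (Set.Ioi 0)) (hχC2 : ContDiffOn ℝ 1 χ' (Set.Ioi 0))
    (hξpos : ∀ r ∈ Set.Ioi (0 : ℝ), 0 < ξ r)
    (hξ'pos : ∀ r ∈ Set.Ioi (0 : ℝ), 0 < ξ' r)
    (hχpos : ∀ r ∈ Set.Ioi (0 : ℝ), 0 < χ r)
    (hχmono : MonotoneOn χ (Set.Ioi 0))
    (hq1pos : ∀ r ∈ Set.Ioi (0 : ℝ), 0 < ξ' r / ξ r)
    (hq1 : StrictAntiOn (fun r => ξ' r / ξ r) (Set.Ioi 0))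
    (hq2 : AntitoneOn (fun r => ξ' r * χ' r / (ξ r * χ r)) (Set.Ioi 0))
    (hqξd : ∀ r ∈ Set.Ioi (0 : ℝ), HasDerivAt (fun t => ξ' t / ξ t) (qξ r) r)
    (hqχd : ∀ r ∈ Set.Ioi (0 : ℝ), HasDerivAt (fun t => χ' t / χ t) (qχ r) r)
    (hξas1 : (fun r => ξ' r / ξ r - 1 / r) =O[𝓝[>] (0 : ℝ)] fun r => r)
    (hξas2 : (fun r => qξ r + 1 / r ^ 2) =O[𝓝[>] (0 : ℝ)] fun _ => (1 : ℝ))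
    (hχas1 : (fun r => χ' r / χ r) =O[𝓝[>] (0 : ℝ)] fun r => r)
    (hχas2 : qχ =O[𝓝[>] (0 : ℝ)] fun _ => (1 : ℝ))
    (hχlim : Tendsto χ (𝓝[>] (0 : ℝ)) (𝓝 1))
    (Γ : ℝ → ℝ)
    (hΓ : ∀ r ∈ Set.Ioi (0 : ℝ), Γ r ∈ Set.Ioo (0 : ℝ) 1 ∧
      Γ r ^ (1 / α) * (1 - Γ r ^ 2) ^ (-(m : ℝ) / 2) =
        cylSm n m ξ ξ' χ χ' r / (c * χ r) ^ (1 / α))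
    (y : ℝ → ℝ)
    (hycont : ContinuousOn y (Set.Ici 0))
    (hymem : ∀ r ∈ Set.Ici (0 : ℝ), y r ∈ Set.Ioc (0 : ℝ) 1)
    (hy0 : y 0 = 1)
    (hyode : ∀ r ∈ Set.Ioi (0 : ℝ),
      HasDerivAt y (solitonG n m α c ξ ξ' χ χ' r (y r)) r ∧ Γ r < y r ∧ y r < 1) :
    Tendsto (fun r => (1 - y r) / r ^ 2) (𝓝[>] (0 : ℝ))
      (𝓝 (1 / 2 * c ^ (2 / ((m : ℝ) * α)) * ((n.choose m : ℝ)) ^ (-(2 : ℝ) / m))) := by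
  have hpL : Tendsto (fun r => r * (ξ' r / ξ r)) (𝓝[>] (0 : ℝ)) (𝓝 1) := by
    have hid : Tendsto (fun r : ℝ => r) (𝓝[>] (0 : ℝ)) (𝓝 0) :=
      tendsto_nhdsWithin_of_tendsto_nhds tendsto_id
    have h1 := hξas1.trans_tendsto hid
    have h2 : Tendsto (fun r => r * (ξ' r / ξ r - 1 / r) + 1) (𝓝[>] (0 : ℝ)) (𝓝 (0 * 0 + 1)) :=
      (hid.mul h1).add_const 1
    simp only [zero_mul, zero_add] at h2
    refine h2.congr' ?_
    filter_upwards [self_mem_nhdsWithin] with r hr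
    have : r ≠ 0 := ne_of_gt hr
    field_simp
    ring
  have hid : Tendsto (fun r : ℝ => r) (𝓝[>] (0 : ℝ)) (𝓝 0) :=
    tendsto_nhdsWithin_of_tendsto_nhds tendsto_id
  have hχ1 : Tendsto (fun r => r * (χ' r / χ r)) (𝓝[>] (0 : ℝ)) (𝓝 0) := by
    simpa using hid.mul (hχas1.trans_tendsto hid)
  have hyL : Tendsto y (𝓝[>] (0 : ℝ)) (𝓝 1) := by
    have h := hycont 0 (by simp)
    rw [ContinuousWithinAt, hy0] at h
    exact h.mono_left (nhdsWithin_mono _ Ioi_subset_Ici_self)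
  have hm0 : (0 : ℝ) < m := by exact_mod_cast (by omega : 0 < m)
  have hα0 : 0 < α := by
    rcases hα with h | h <;> rw [h]
    · norm_num
    · positivity
  obtain ⟨A, hA⟩ : ∃ A : ℝ, A = ((n - 1).choose (m - 1) : ℝ) := ⟨_, rfl⟩
  obtain ⟨B, hB⟩ : ∃ B : ℝ, B = ((n - 1).choose m : ℝ) := ⟨_, rfl⟩
  have hA0 : 0 < A := by
    rw [hA]; exact_mod_cast Nat.choose_pos (by omega)
  have hB0 : 0 < B := by
    rw [hB]; exact_mod_cast Nat.choose_pos (by omega)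
  have hAB : (n.choose m : ℝ) = A + B := by
    rw [hA, hB]
    obtain ⟨n', rfl⟩ : ∃ n', n = n' + 1 := ⟨n - 1, by omega⟩
    obtain ⟨m', rfl⟩ : ∃ m', m = m' + 1 := ⟨m - 1, by omega⟩
    rw [Nat.choose_succ_succ]
    push_cast
    simp
  obtain ⟨k, hk⟩ : ∃ k : ℝ, k = m * B / A := ⟨_, rfl⟩
  have hk0 : 0 < k := by rw [hk]; positivity
  have hw : ∀ r ∈ Set.Ioi (0 : ℝ), 0 < 1 - y r ^ 2 := by
    intro r hr
    have h1 := (hymem r (Set.Ioi_subset_Ici_self hr)).1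
    have h2 := (hyode r hr).2.2
    nlinarith
  have hPd : ∀ r ∈ Set.Ioi (0 : ℝ), HasDerivAt (fun r => ξ r ^ k)
      (ξ r ^ k * (k * (ξ' r / ξ r))) r := by
    intro r hr
    have h := (hξd r hr).rpow_const (p := k) (Or.inl (hξpos r hr).ne')
    refine h.congr_deriv ?_
    rw [Real.rpow_sub_one (hξpos r hr).ne']
    ring
  have hXd : ∀ r ∈ Set.Ioi (0 : ℝ), HasDerivAt (fun r => χ r ^ m)
      (χ r ^ m * (m * (χ' r / χ r))) r := by
    intro r hr
    have h := (hχd r hr).fun_pow m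
    refine h.congr_deriv ?_
    have h0 := (hχpos r hr).ne'
    obtain ⟨m', rfl⟩ : ∃ m', m = m' + 1 := ⟨m - 1, by omega⟩
    simp only [Nat.add_sub_cancel]
    field_simp
    ring
  have hud : ∀ r ∈ Set.Ioi (0 : ℝ), HasDerivAt (fun r => (1 - y r ^ 2) ^ ((m : ℝ) / 2))
      ((m / A) * (ξ r / ξ' r) ^ (m - 1) * ((c * χ r) ^ (1 / α) * y r ^ (1 / α))
        - (m * (χ' r / χ r) + k * (ξ' r / ξ r)) * (1 - y r ^ 2) ^ ((m : ℝ) / 2)) r := by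
    intro r hr
    have hw0 := hw r hr
    have hy1 := (hymem r (Set.Ioi_subset_Ici_self hr)).1
    have h := (((hyode r hr).1.fun_pow 2).const_sub 1).rpow_const (p := (m : ℝ) / 2) (Or.inl hw0.ne')
    refine h.congr_deriv ?_
    rw [Real.rpow_sub_one hw0.ne']
    unfold solitonG cylSm
    rw [← hA, ← hB, neg_div, Real.rpow_neg hw0.le]
    have hu0 : 0 < (1 - y r ^ 2) ^ ((m : ℝ) / 2) := Real.rpow_pos_of_pos hw0 _
    generalize (1 - y r ^ 2) ^ ((m : ℝ) / 2) = u at hu0 ⊢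
    generalize 1 - y r ^ 2 = w at hw0 ⊢
    generalize (c * χ r) ^ (1 / α) * y r ^ (1 / α) = H
    have hξ0 := hξpos r hr
    have hξ'0 := hξ'pos r hr
    have e : (ξ r / ξ' r) ^ (m - 1) * (ξ' r / ξ r) ^ (m - 1) = 1 := by
      rw [← mul_pow]
      have : ξ r / ξ' r * (ξ' r / ξ r) = 1 := by field_simp
      rw [this, one_pow]
    generalize (ξ r / ξ' r) ^ (m - 1) = Q at e ⊢
    generalize (ξ' r / ξ r) ^ (m - 1) = R at e ⊢
    generalize ξ' r / ξ r = p
    generalize χ' r / χ r = q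
    rw [hk]
    have hAne := hA0.ne'
    have hwne := hw0.ne'
    have hune := hu0.ne'
    have hyne := hy1.ne'
    have e2 : A⁻¹ * Q * (w / y r) * ((A * q + B * p) * R - H * u⁻¹)
      = A⁻¹ * (w / y r) * ((A * q + B * p) * (Q * R) - Q * H * u⁻¹) := by ring
    rw [e2, e]
    push_cast
    field_simp
    ring
  have hFd : ∀ r ∈ Set.Ioi (0 : ℝ), HasDerivAt
      (fun r => ξ r ^ k * χ r ^ m * (1 - y r ^ 2) ^ ((m : ℝ) / 2))
      (ξ r ^ k * χ r ^ m *
        ((m / A) * (ξ r / ξ' r) ^ (m - 1) * ((c * χ r) ^ (1 / α) * y r ^ (1 / α)))) r := by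
    intro r hr
    have h := ((hPd r hr).fun_mul (hXd r hr)).fun_mul (hud r hr)
    refine h.congr_deriv ?_
    ring
  have hGd : ∀ r ∈ Set.Ioi (0 : ℝ), HasDerivAt
      (fun r => ξ r ^ k * χ r ^ m * r ^ m)
      (ξ r ^ k * χ r ^ m *
        (r ^ (m - 1) * (k * (r * (ξ' r / ξ r)) + m * (r * (χ' r / χ r)) + m))) r := by
    intro r hr
    have h := ((hPd r hr).fun_mul (hXd r hr)).fun_mul (hasDerivAt_pow m r)
    refine h.congr_deriv ?_
    obtain ⟨m', rfl⟩ : ∃ m', m = m' + 1 := ⟨m - 1, by omega⟩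
    simp only [Nat.add_sub_cancel]
    ring
  have hD : Tendsto (fun r => k * (r * (ξ' r / ξ r)) + m * (r * (χ' r / χ r)) + m)
      (𝓝[>] (0 : ℝ)) (𝓝 (k * 1 + m * 0 + m)) :=
    ((hpL.const_mul k).add (hχ1.const_mul (m : ℝ))).add_const _
  have hDpos : 0 < k * 1 + m * 0 + (m : ℝ) := by linarith
  have hDev := hD.eventually_const_lt hDpos
  have hpre : ∀ r ∈ Set.Ioi (0 : ℝ), 0 < ξ r ^ k * χ r ^ m := fun r hr =>
    mul_pos (Real.rpow_pos_of_pos (hξpos r hr) _) (pow_pos (hχpos r hr) _)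
  -- boundedness of the integrating factor
  have hmono : MonotoneOn ξ (Set.Ioi 0) := by
    refine monotoneOn_of_deriv_nonneg (convex_Ioi 0)
      (fun r hr => (hξd r hr).continuousAt.continuousWithinAt)
      (fun r hr => ?_) (fun r hr => ?_)
    · rw [interior_Ioi] at hr
      exact (hξd r hr).differentiableAt.differentiableWithinAt
    · rw [interior_Ioi] at hr
      rw [(hξd r hr).deriv]
      exact (hξ'pos r hr).le
  have hbd : ∀ᶠ r in 𝓝[>] (0 : ℝ), ‖ξ r ^ k * χ r ^ m‖ ≤ ξ 1 ^ k * χ 1 ^ m := by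
    filter_upwards [Ioo_mem_nhdsGT (zero_lt_one' ℝ)] with r hr
    have hr0 : r ∈ Set.Ioi (0 : ℝ) := hr.1
    have h1 : (1 : ℝ) ∈ Set.Ioi (0 : ℝ) := by simp
    rw [Real.norm_of_nonneg (hpre r hr0).le]
    have hx := hξpos r hr0
    have hc' := hχpos r hr0
    have := hξpos 1 h1
    have i1 : ξ r ≤ ξ 1 := hmono hr0 h1 hr.2.le
    have i2 : χ r ≤ χ 1 := hχmono hr0 h1 hr.2.le
    exact mul_le_mul (Real.rpow_le_rpow hx.le i1 hk0.le) (pow_le_pow_left₀ hc'.le i2 m)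
      (by positivity) (by positivity)
  have hwL : Tendsto (fun r => 1 - y r ^ 2) (𝓝[>] (0 : ℝ)) (𝓝 0) := by
    simpa using (hyL.pow 2).const_sub 1
  have huL : Tendsto (fun r => (1 - y r ^ 2) ^ ((m : ℝ) / 2)) (𝓝[>] (0 : ℝ)) (𝓝 0) := by
    have hm2 : 0 < (m : ℝ) / 2 := by positivity
    have h := hwL.rpow_const (p := (m : ℝ) / 2) (Or.inr hm2.le)
    rwa [Real.zero_rpow hm2.ne'] at h
  have hbd' : IsBoundedUnder (· ≤ ·) (𝓝[>] (0 : ℝ)) ((fun x => ‖x‖) ∘ fun r => ξ r ^ k * χ r ^ m) :=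
    ⟨_, by simpa using hbd⟩
  have hF0 : Tendsto (fun r => ξ r ^ k * χ r ^ m * (1 - y r ^ 2) ^ ((m : ℝ) / 2))
      (𝓝[>] (0 : ℝ)) (𝓝 0) := by
    exact isBoundedUnder_le_mul_tendsto_zero hbd' huL
  have hG0 : Tendsto (fun r => ξ r ^ k * χ r ^ m * r ^ m) (𝓝[>] (0 : ℝ)) (𝓝 0) := by
    refine isBoundedUnder_le_mul_tendsto_zero hbd' ?_
    have h := hid.pow m
    rwa [zero_pow (by omega)] at h
  have hinv : Tendsto (fun r => (r * (ξ' r / ξ r))⁻¹) (𝓝[>] (0 : ℝ)) (𝓝 1) := by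
    simpa using hpL.inv₀ one_ne_zero
  have hnum : Tendsto (fun r => (m / A) * ((r * (ξ' r / ξ r))⁻¹) ^ (m - 1) *
      ((c * χ r) ^ (1 / α) * y r ^ (1 / α))) (𝓝[>] (0 : ℝ))
      (𝓝 ((m / A) * 1 ^ (m - 1) * ((c * 1) ^ (1 / α) * 1 ^ (1 / α)))) :=
    ((hinv.pow (m - 1)).const_mul _).mul
      (((hχlim.const_mul c).rpow_const (Or.inl (by simpa using hc.ne'))).mul
        (hyL.rpow_const (Or.inl one_ne_zero)))
  have hL : Tendsto (fun r => (ξ r ^ k * χ r ^ m * (1 - y r ^ 2) ^ ((m : ℝ) / 2)) /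
      (ξ r ^ k * χ r ^ m * r ^ m)) (𝓝[>] (0 : ℝ)) (𝓝 (c ^ (1 / α) / (A + B))) := by
    refine HasDerivAt.lhopital_zero_nhdsGT
      (eventually_mem_nhdsWithin.mono hFd) (eventually_mem_nhdsWithin.mono hGd) ?_ hF0 hG0 ?_
    · filter_upwards [hDev, self_mem_nhdsWithin] with r h1 hr
      have := hpre r hr
      have hr' : 0 < r := hr
      positivity
    · have h := hnum.div hD hDpos.ne'
      have e : (m / A) * 1 ^ (m - 1) * ((c * 1) ^ (1 / α) * 1 ^ (1 / α)) / (k * 1 + m * 0 + m)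
          = c ^ (1 / α) / (A + B) := by
        rw [hk, Real.one_rpow]
        simp only [mul_one, one_pow, mul_zero, add_zero]
        field_simp
        ring
      rw [e] at h
      refine h.congr' ?_
      filter_upwards [hDev, self_mem_nhdsWithin] with r h1 hr
      have h2 := hpre r hr
      have hr' : 0 < r := hr
      have e3 : (ξ r / ξ' r) ^ (m - 1) = r ^ (m - 1) * ((r * (ξ' r / ξ r))⁻¹) ^ (m - 1) := by
        rw [← mul_pow]
        congr 1
        have := hξpos r hr
        have := hξ'pos r hr
        field_simp
      simp only [Pi.div_apply]
      rw [e3, mul_div_mul_left _ _ h2.ne']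
      have h3 : 0 < r ^ (m - 1) := by positivity
      rw [← mul_div_mul_left _ _ h3.ne']
      congr 1
      ring
  have hCpos : 0 < c ^ (1 / α) / (A + B) := by
    have := Real.rpow_pos_of_pos hc (1 / α)
    positivity
  have hL2 := hL.rpow_const (p := 2 / (m : ℝ)) (Or.inl hCpos.ne')
  have hL3 := hL2.div (hyL.const_add 1) (by norm_num)
  have efin : (c ^ (1 / α) / (A + B)) ^ (2 / (m : ℝ)) / (1 + 1)
      = 1 / 2 * c ^ (2 / ((m : ℝ) * α)) * ((n.choose m : ℝ)) ^ (-(2 : ℝ) / m) := by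
    rw [hAB, Real.div_rpow (by positivity) (by positivity), ← Real.rpow_mul hc.le, neg_div,
      Real.rpow_neg (by positivity)]
    have : 1 / α * (2 / (m : ℝ)) = 2 / ((m : ℝ) * α) := by field_simp
    rw [this]
    ring
  rw [efin] at hL3
  refine hL3.congr' ?_
  filter_upwards [self_mem_nhdsWithin] with r hr
  have hr' : 0 < r := hr
  have h2 := hpre r hr
  have hw0 := hw r hr
  have hy1 := (hymem r hr'.le).1
  simp only [Pi.div_apply]
  rw [mul_div_mul_left _ _ h2.ne', Real.div_rpow (by positivity) (by positivity),
    ← Real.rpow_mul hw0.le, ← Real.rpow_natCast r m, ← Real.rpow_mul hr'.le]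
  have e1 : (m : ℝ) / 2 * (2 / m) = 1 := by field_simp
  have e2 : (m : ℝ) * (2 / m) = (2 : ℕ) := by push_cast; field_simp
  rw [e1, e2, Real.rpow_one, Real.rpow_natCast]
  have : 1 + y r ≠ 0 := by positivity
  field_simp
  ring
end

section
/- Under the hypotheses of the bowl-soliton existence statement (n ≥ 3, 2 ≤ m < n, α ∈ {1, 1/m}, c > 0, ξ, χ twice continuously differentiable positive with the structural monotonicity conditions and the expansions ξ'/ξ = 1/r + O(r), (ξ'/ξ)' = −1/r² + O(1), χ'/χ = O(r), (χ'/χ)' = O(1), χ(r) → 1 as r → 0⁺), let y : [0, ∞) → (0, 1] be the unique solution of y' = G(r, y) with y(0) = 1, and set φ(r) = arccos(y(r)) ∈ [0, π/2). Then lim_{r→0⁺} φ(r)/r = c^{1/(mα)} C(n, m)^{−1/m}, where C(n, m) is the binomial coefficient. -/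
open Real Set Filter Topology Asymptotics

/-- With `φ = arccos ∘ y` the angle of the bowl-type soliton,
`φ(r)/r → c^{1/(mα)} C(n,m)^{-1/m}` as `r → 0⁺`. -/
theorem stmt12 (n m : ℕ) (hn : 3 ≤ n) (hm : 2 ≤ m) (hmn : m < n)
    (α c : ℝ) (hα : α = 1 ∨ α = 1 / m) (hc : 0 < c)
    (ξ χ ξ' χ' qξ qχ : ℝ → ℝ)
    (hξd : ∀ r ∈ Set.Ioi (0 : ℝ), HasDerivAt ξ (ξ' r) r)
    (hχd : ∀ r ∈ Set.Ioi (0 : ℝ), HasDerivAt χ (χ' r) r)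
    (hξC2 : ContDiffOn ℝ 1 ξ' (Set.Ioi 0)) (hχC2 : ContDiffOn ℝ 1 χ' (Set.Ioi 0))
    (hξpos : ∀ r ∈ Set.Ioi (0 : ℝ), 0 < ξ r)
    (hξ'pos : ∀ r ∈ Set.Ioi (0 : ℝ), 0 < ξ' r)
    (hχpos : ∀ r ∈ Set.Ioi (0 : ℝ), 0 < χ r)
    (hχmono : MonotoneOn χ (Set.Ioi 0))
    (hq1pos : ∀ r ∈ Set.Ioi (0 : ℝ), 0 < ξ' r / ξ r)
    (hq1 : StrictAntiOn (fun r => ξ' r / ξ r) (Set.Ioi 0))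
    (hq2 : AntitoneOn (fun r => ξ' r * χ' r / (ξ r * χ r)) (Set.Ioi 0))
    (hqξd : ∀ r ∈ Set.Ioi (0 : ℝ), HasDerivAt (fun t => ξ' t / ξ t) (qξ r) r)
    (hqχd : ∀ r ∈ Set.Ioi (0 : ℝ), HasDerivAt (fun t => χ' t / χ t) (qχ r) r)
    (hξas1 : (fun r => ξ' r / ξ r - 1 / r) =O[𝓝[>] (0 : ℝ)] fun r => r)
    (hξas2 : (fun r => qξ r + 1 / r ^ 2) =O[𝓝[>] (0 : ℝ)] fun _ => (1 : ℝ))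
    (hχas1 : (fun r => χ' r / χ r) =O[𝓝[>] (0 : ℝ)] fun r => r)
    (hχas2 : qχ =O[𝓝[>] (0 : ℝ)] fun _ => (1 : ℝ))
    (hχlim : Tendsto χ (𝓝[>] (0 : ℝ)) (𝓝 1))
    (Γ : ℝ → ℝ)
    (hΓ : ∀ r ∈ Set.Ioi (0 : ℝ), Γ r ∈ Set.Ioo (0 : ℝ) 1 ∧
      Γ r ^ (1 / α) * (1 - Γ r ^ 2) ^ (-(m : ℝ) / 2) =
        cylSm n m ξ ξ' χ χ' r / (c * χ r) ^ (1 / α))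
    (y : ℝ → ℝ)
    (hycont : ContinuousOn y (Set.Ici 0))
    (hymem : ∀ r ∈ Set.Ici (0 : ℝ), y r ∈ Set.Ioc (0 : ℝ) 1)
    (hy0 : y 0 = 1)
    (hyode : ∀ r ∈ Set.Ioi (0 : ℝ),
      HasDerivAt y (solitonG n m α c ξ ξ' χ χ' r (y r)) r ∧ Γ r < y r ∧ y r < 1) :
    Tendsto (fun r => Real.arccos (y r) / r) (𝓝[>] (0 : ℝ))
      (𝓝 (c ^ (1 / ((m : ℝ) * α)) * ((n.choose m : ℝ)) ^ (-(1 : ℝ) / m))) := by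
  have hm0 : (0 : ℝ) < m := by exact_mod_cast (by omega : 0 < m)
  have hn0 : (0 : ℝ) < n := by exact_mod_cast (by omega : 0 < n)
  have hC : (0 : ℝ) < ((n - 1).choose (m - 1) : ℝ) := by
    exact_mod_cast Nat.choose_pos (by omega)
  have hCn : (0 : ℝ) < (n.choose m : ℝ) := by
    exact_mod_cast Nat.choose_pos (by omega)
  have hD : ((n - 1).choose m : ℝ) * m = ((n - 1).choose (m - 1) : ℝ) * ((n - m : ℕ) : ℝ) := by
    have := Nat.choose_succ_right_eq (n - 1) (m - 1)
    rw [show m - 1 + 1 = m by omega, show n - 1 - (m - 1) = n - m by omega] at this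
    exact_mod_cast this
  have hNC : (n : ℝ) * ((n - 1).choose (m - 1) : ℝ) = (n.choose m : ℝ) * m := by
    have := Nat.add_one_mul_choose_eq (n - 1) (m - 1)
    rw [show m - 1 + 1 = m by omega, show n - 1 + 1 = n by omega] at this
    exact_mod_cast this
  have hnm : ((n - m : ℕ) : ℝ) = n - m := by push_cast [hmn.le]; ring
  have hpos : ∀ᶠ r in 𝓝[>] (0 : ℝ), 0 < r := eventually_mem_nhdsWithin
  have hid : Tendsto (fun r : ℝ => r) (𝓝[>] (0 : ℝ)) (𝓝 0) := tendsto_id.mono_left nhdsWithin_le_nhds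
  -- limits
  have hylim : Tendsto y (𝓝[>] (0 : ℝ)) (𝓝 1) := by
    have h := hycont 0 (by simp)
    rw [ContinuousWithinAt, hy0] at h
    exact h.mono_left (nhdsWithin_mono _ Ioi_subset_Ici_self)
  have hrr : Tendsto (fun r : ℝ => r * r) (𝓝[>] (0 : ℝ)) (𝓝 0) := by simpa using hid.mul hid
  have hqr : Tendsto (fun r => ξ' r / ξ r * r) (𝓝[>] (0 : ℝ)) (𝓝 1) := by
    have h1 := (hξas1.mul (isBigO_refl (fun r : ℝ => r) _)).trans_tendsto hrr
    have h2 := h1.add_const 1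
    rw [zero_add] at h2
    refine h2.congr' ?_
    filter_upwards [hpos] with r hr
    field_simp
    ring
  have hpr : Tendsto (fun r => χ' r / χ r * r) (𝓝[>] (0 : ℝ)) (𝓝 0) :=
    (hχas1.mul (isBigO_refl (fun r : ℝ => r) _)).trans_tendsto hrr
  have hK : Tendsto (fun r => (c * χ r) ^ (1 / α) * y r ^ (1 / α)) (𝓝[>] (0 : ℝ))
      (𝓝 (c ^ (1 / α))) := by
    have h1 : Tendsto (fun r => c * χ r) (𝓝[>] (0 : ℝ)) (𝓝 c) := by
      simpa using hχlim.const_mul c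
    have h2 := (h1.rpow_const (p := 1 / α) (Or.inl hc.ne')).mul
      (hylim.rpow_const (p := 1 / α) (Or.inl one_ne_zero))
    simpa using h2
  have hB : Tendsto (fun r => m * (χ' r / χ r * r) + ((n - m : ℕ) : ℝ) * (ξ' r / ξ r * r) + m)
      (𝓝[>] (0 : ℝ)) (𝓝 n) := by
    have h := ((hpr.const_mul (m : ℝ)).add (hqr.const_mul ((n - m : ℕ) : ℝ))).add_const (m : ℝ)
    rw [hnm] at h
    rw [hnm]
    convert h using 2
    ring
  have hu : Tendsto (fun r => 1 - y r ^ 2) (𝓝[>] (0 : ℝ)) (𝓝 0) := by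
    simpa using (hylim.pow 2).const_sub 1
  have hw : Tendsto (fun r => (1 - y r ^ 2) ^ ((m : ℝ) / 2)) (𝓝[>] (0 : ℝ)) (𝓝 0) := by
    have h := hu.rpow_const (p := (m : ℝ) / 2) (Or.inr (by positivity))
    rwa [Real.zero_rpow (by positivity)] at h
  have hmono : StrictMonoOn ξ (Ioi 0) := by
    refine strictMonoOn_of_deriv_pos (convex_Ioi 0)
      (fun r hr => (hξd r hr).continuousAt.continuousWithinAt) ?_
    intro r hr
    rw [interior_Ioi] at hr
    rw [(hξd r hr).deriv]
    exact hξ'pos r hr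
  have hbd : ∀ g : ℝ → ℝ, Tendsto g (𝓝[>] (0 : ℝ)) (𝓝 0) →
      Tendsto (fun r => χ r ^ m * ξ r ^ (n - m) * g r) (𝓝[>] (0 : ℝ)) (𝓝 0) := by
    intro g hg
    have h1 : Tendsto (fun r => χ r ^ m * g r) (𝓝[>] (0 : ℝ)) (𝓝 0) := by
      simpa using (hχlim.pow m).mul hg
    have h2 : (fun r => ξ r ^ (n - m)) =O[𝓝[>] (0 : ℝ)] (fun _ => (1 : ℝ)) := by
      refine IsBigO.of_bound (ξ 1 ^ (n - m)) ?_
      filter_upwards [Ioo_mem_nhdsGT (zero_lt_one' ℝ)] with r hr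
      have hp := hξpos r hr.1
      rw [norm_one, mul_one, Real.norm_of_nonneg (by positivity)]
      exact pow_le_pow_left₀ hp.le (hmono hr.1 (by simp) hr.2).le _
    have h3 := (h2.mul (isBigO_refl (fun r => χ r ^ m * g r) _))
    have h4 := h3.trans_tendsto (by simpa using h1)
    refine h4.congr fun r => ?_
    ring
  have hE : ∀ r, 0 < r → HasDerivAt (fun r => χ r ^ m * ξ r ^ (n - m))
      (χ r ^ m * ξ r ^ (n - m) *
        (m * (χ' r / χ r) + ((n - m : ℕ) : ℝ) * (ξ' r / ξ r))) r := by
    intro r hr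
    have hx := hχpos r hr
    have hz := hξpos r hr
    have h := ((hχd r hr).pow m).mul ((hξd r hr).pow (n - m))
    refine h.congr_deriv ?_
    have e1 : χ r ^ m = χ r ^ (m - 1) * χ r := by
      rw [← pow_succ]; congr 1; omega
    have e2 : ξ r ^ (n - m) = ξ r ^ (n - m - 1) * ξ r := by
      rw [← pow_succ]; congr 1; omega
    simp only [Pi.pow_apply]
    rw [e1, e2]
    field_simp
  have hwd : ∀ r, 0 < r → HasDerivAt (fun r => (1 - y r ^ 2) ^ ((m : ℝ) / 2))
      (-(m * (χ' r / χ r) + ((n - m : ℕ) : ℝ) * (ξ' r / ξ r)) * (1 - y r ^ 2) ^ ((m : ℝ) / 2)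
        + m / ((n - 1).choose (m - 1) : ℝ) * (ξ r / ξ' r) ^ (m - 1) *
          ((c * χ r) ^ (1 / α) * y r ^ (1 / α))) r := by
    intro r hr
    obtain ⟨hd, -, hlt⟩ := hyode r hr
    have hyp : 0 < y r := (hymem r (le_of_lt hr)).1
    have hup : 0 < 1 - y r ^ 2 := by nlinarith
    have h := ((hd.pow 2).const_sub 1).rpow_const (p := (m : ℝ) / 2) (Or.inl hup.ne')
    refine h.congr_deriv ?_
    have hz := hξpos r hr
    have hz' := hξ'pos r hr
    have e1 : (1 - y r ^ 2) ^ ((m : ℝ) / 2 - 1) = (1 - y r ^ 2) ^ ((m : ℝ) / 2) / (1 - y r ^ 2) := by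
      rw [Real.rpow_sub hup, Real.rpow_one]
    have e2 : (1 - y r ^ 2) ^ (-(m : ℝ) / 2) = ((1 - y r ^ 2) ^ ((m : ℝ) / 2))⁻¹ := by
      rw [neg_div, Real.rpow_neg hup.le]
    have hW : 0 < (1 - y r ^ 2) ^ ((m : ℝ) / 2) := Real.rpow_pos_of_pos hup _
    have e3 : (ξ r / ξ' r) ^ (m - 1) * (ξ' r / ξ r) ^ (m - 1) = 1 := by
      rw [← mul_pow, div_mul_div_cancel₀ hz'.ne', div_self hz.ne', one_pow]
    have e4 : ((n - m : ℕ) : ℝ) = ((n - 1).choose m : ℝ) * m / ((n - 1).choose (m - 1) : ℝ) := by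
      rw [hD]; field_simp
    simp only [Pi.pow_apply, solitonG, cylSm]
    rw [e1, e2, e4]
    generalize (1 - y r ^ 2) ^ ((m : ℝ) / 2) = W at *
    generalize (c * χ r) ^ (1 / α) = A at *
    generalize y r ^ (1 / α) = Y at *
    generalize (ξ r / ξ' r) ^ (m - 1) = Q at *
    generalize (ξ' r / ξ r) ^ (m - 1) = Q' at *
    generalize χ' r / χ r = p at *
    generalize ξ' r / ξ r = q at *
    generalize ((n - 1).choose (m - 1) : ℝ) = C at *
    generalize ((n - 1).choose m : ℝ) = D at *
    generalize 1 - y r ^ 2 = u at *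
    norm_num
    field_simp
    linear_combination (-(C * p + D * q) * W) * e3
  have hlim : Tendsto (fun r => (χ r ^ m * ξ r ^ (n - m) * (1 - y r ^ 2) ^ ((m : ℝ) / 2)) /
      (χ r ^ m * ξ r ^ (n - m) * r ^ m)) (𝓝[>] (0 : ℝ)) (𝓝 (c ^ (1 / α) / (n.choose m : ℝ))) := by
    have hF : ∀ r, 0 < r → HasDerivAt
        (fun r => χ r ^ m * ξ r ^ (n - m) * (1 - y r ^ 2) ^ ((m : ℝ) / 2))
        (χ r ^ m * ξ r ^ (n - m) * (m / ((n - 1).choose (m - 1) : ℝ) * (ξ r / ξ' r) ^ (m - 1) *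
          ((c * χ r) ^ (1 / α) * y r ^ (1 / α)))) r := by
      intro r hr
      refine ((hE r hr).mul (hwd r hr)).congr_deriv ?_
      ring
    have hG : ∀ r, 0 < r → HasDerivAt
        (fun r => χ r ^ m * ξ r ^ (n - m) * r ^ m)
        (χ r ^ m * ξ r ^ (n - m) * (r ^ (m - 1) *
          (m * (χ' r / χ r * r) + ((n - m : ℕ) : ℝ) * (ξ' r / ξ r * r) + m))) r := by
      intro r hr
      refine ((hE r hr).mul (hasDerivAt_pow m r)).congr_deriv ?_
      have e1 : r ^ m = r ^ (m - 1) * r := by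
        rw [← pow_succ]; congr 1; omega
      rw [e1]
      ring
    have hBpos := hB.eventually (lt_mem_nhds hn0)
    refine HasDerivAt.lhopital_zero_nhdsGT (hpos.mono hF) (hpos.mono hG) ?_ (hbd _ hw)
      (hbd _ ?_) ?_
    · filter_upwards [hpos, hBpos] with r hr hb
      have hx := hχpos r hr
      have hz := hξpos r hr
      have := pow_pos hr (m - 1)
      exact (mul_pos (by positivity) (mul_pos this hb)).ne'
    · have := hid.pow m
      rwa [zero_pow (by omega)] at this
    · have h := (((hqr.pow (m - 1)).inv₀ (by simp)).mul
        (hK.const_mul (m / ((n - 1).choose (m - 1) : ℝ)))).div hB hn0.ne'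
      have e : c ^ (1 / α) / (n.choose m : ℝ) =
          (1 ^ (m - 1))⁻¹ * (m / ((n - 1).choose (m - 1) : ℝ) * c ^ (1 / α)) / n := by
        rw [one_pow]
        field_simp
        linear_combination hNC
      rw [e]
      refine h.congr' ?_
      filter_upwards [hpos, hBpos] with r hr hb
      have hx := hχpos r hr
      have hz := hξpos r hr
      have hz' := hξ'pos r hr
      have hEp : 0 < χ r ^ m * ξ r ^ (n - m) := by positivity
      rw [mul_div_mul_left _ _ hEp.ne']
      simp only [Pi.div_apply]
      generalize (m * (χ' r / χ r * r) + ((n - m : ℕ) : ℝ) * (ξ' r / ξ r * r) + m) = B at *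
      rw [mul_pow, div_pow, div_pow]
      field_simp
  have hsin : Tendsto (fun r => √(1 - y r ^ 2) / r) (𝓝[>] (0 : ℝ))
      (𝓝 (c ^ (1 / ((m : ℝ) * α)) * ((n.choose m : ℝ)) ^ (-(1 : ℝ) / m))) := by
    have h := hlim.rpow_const (p := 1 / (m : ℝ)) (Or.inr (by positivity))
    have e : (c ^ (1 / α) / (n.choose m : ℝ)) ^ (1 / (m : ℝ)) =
        c ^ (1 / ((m : ℝ) * α)) * ((n.choose m : ℝ)) ^ (-(1 : ℝ) / m) := by
      rw [Real.div_rpow (by positivity) hCn.le, ← Real.rpow_mul hc.le, neg_div,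
        Real.rpow_neg hCn.le, div_eq_mul_inv]
      congr 2
      rw [one_div, one_div, one_div, mul_inv, mul_comm]
    rw [e] at h
    refine h.congr' ?_
    filter_upwards [hpos] with r hr
    have hx := hχpos r hr
    have hz := hξpos r hr
    obtain ⟨-, -, hlt⟩ := hyode r hr
    have hyp : 0 < y r := (hymem r (le_of_lt hr)).1
    have hup : 0 < 1 - y r ^ 2 := by nlinarith
    have hEp : 0 < χ r ^ m * ξ r ^ (n - m) := by positivity
    rw [mul_div_mul_left _ _ hEp.ne', Real.div_rpow (by positivity) (by positivity),
      ← Real.rpow_mul hup.le, ← Real.rpow_natCast r m, ← Real.rpow_mul hr.le,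
      Real.sqrt_eq_rpow]
    congr 1
    · congr 1; field_simp
    · rw [mul_one_div_cancel hm0.ne', Real.rpow_one]
  have hφ : Tendsto (fun r => Real.arccos (y r)) (𝓝[>] (0 : ℝ)) (𝓝[≠] 0) := by
    refine tendsto_nhdsWithin_iff.2 ⟨?_, ?_⟩
    · have := (Real.continuous_arccos.tendsto 1).comp hylim
      rwa [Real.arccos_one] at this
    · filter_upwards [hpos] with r hr
      exact (Real.arccos_pos.2 (hyode r hr).2.2).ne'
  have hs1 : Tendsto (fun x : ℝ => Real.sin x / x) (𝓝[≠] 0) (𝓝 1) := by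
    have h := (Real.hasDerivAt_sin 0).tendsto_slope_zero
    simp only [zero_add, Real.sin_zero, sub_zero, Real.cos_zero, smul_eq_mul] at h
    refine h.congr fun x => ?_
    rw [div_eq_inv_mul]
  have hfin := ((hs1.comp hφ).inv₀ one_ne_zero).mul hsin
  rw [inv_one, one_mul] at hfin
  refine hfin.congr' ?_
  filter_upwards [hpos] with r hr
  obtain ⟨-, -, hlt⟩ := hyode r hr
  have hyp : 0 < y r := (hymem r (le_of_lt hr)).1
  have hup : 0 < 1 - y r ^ 2 := by nlinarith
  have hsp := Real.sqrt_pos.2 hup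
  have hap := Real.arccos_pos.2 hlt
  simp only [Function.comp, Real.sin_arccos]
  field_simp
end
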